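/- Let T, C be real constants, U ⊆ ℝ³ open, let ω⁰, ω¹, ω² : U → (ℝ³)* be C¹ 1-forms that are linearly independent at every point of U, and let ε, P : U → ℝ be C² functions satisfying dω⁰ = −T ω⁰∧ω¹, dω¹ = −4T ω⁰∧ω², dω² = ω⁰∧ω¹ + 2ε ω⁰∧ω² − T ω¹∧ω², and dε = P ω⁰ − Tε ω¹ + C ω² on U. Then, writing dP = P₁ ω⁰ + Q ω¹ + R ω² with (uniquely determined) functions P₁, Q, R : U → ℝ, one has Q = C − 2TP and R = 2(C + 2T²)ε on U. -/

import Mathlib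

open Real

/-- Points of `ℝ³`. -/
abbrev Pt : Type := Fin 3 → ℝ

/-- A 1-form on an open set of `ℝ³`: a field of continuous linear functionals. -/
abbrev OneForm : Type := Pt → (Pt →L[ℝ] ℝ)

/-- The exterior derivative of a 1-form, via the Fréchet derivative:
`dω_p(X,Y) = (Dω_p X)(Y) − (Dω_p Y)(X)`. -/
noncomputable def extd (ω : OneForm) (p : Pt) (X Y : Pt) : ℝ :=
  fderiv ℝ ω p X Y - fderiv ℝ ω p Y X

/-- The wedge of two 1-forms: `(ω∧σ)_p(X,Y) = ω_p(X)σ_p(Y) − ω_p(Y)σ_p(X)`. -/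
def wedge (ω σ : OneForm) (p : Pt) (X Y : Pt) : ℝ :=
  ω p X * σ p Y - ω p Y * σ p X

/-- A linearly independent triple of functionals on `ℝ³` takes arbitrary prescribed values. -/
theorem exists_apply_eq_of_linearIndependent {f : Fin 3 → (Pt →L[ℝ] ℝ)}
    (hf : LinearIndependent ℝ f) (v : Fin 3 → ℝ) : ∃ X : Pt, ∀ i, f i X = v i := by
  let A : Matrix (Fin 3) (Fin 3) ℝ := Matrix.of fun i j => f i (Pi.single j 1)
  have happ (g : Pt →L[ℝ] ℝ) (X : Pt) : g X = ∑ j, g (Pi.single j 1) * X j := by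
    conv_lhs => rw [pi_eq_sum_univ' X]
    simp [map_sum, mul_comm]
  have hA : IsUnit A := by
    rw [← Matrix.linearIndependent_rows_iff_isUnit, Fintype.linearIndependent_iff]
    intro c hc
    refine Fintype.linearIndependent_iff.mp hf c ?_
    ext X
    rw [happ]
    refine (Finset.sum_eq_zero fun j _ => ?_).trans (by simp)
    have := congrFun hc j
    simp only [Finset.sum_apply, Pi.smul_apply, Matrix.row, A, Matrix.of_apply,
      Pi.zero_apply, smul_eq_mul] at this
    simp [this]
  obtain ⟨X, hX⟩ := Matrix.mulVec_surjective_iff_isUnit.mpr hA v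
  refine ⟨X, fun i => ?_⟩
  rw [happ, ← hX]
  rfl

/-- A function multiplying a 1-form: `d(gω) = dg ∧ ω + g dω`. -/
theorem extd_smul {g : Pt → ℝ} {ω : OneForm} {p : Pt} (hg : DifferentiableAt ℝ g p)
    (hω : DifferentiableAt ℝ ω p) (X Y : Pt) :
    extd (fun q => g q • ω q) p X Y = wedge (fderiv ℝ g) ω p X Y + g p * extd ω p X Y := by
  simp only [extd, wedge, fderiv_fun_smul hg hω]
  simp
  ring

theorem extd_add {ω σ : OneForm} {p : Pt} (hω : DifferentiableAt ℝ ω p)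
    (hσ : DifferentiableAt ℝ σ p) (X Y : Pt) :
    extd (fun q => ω q + σ q) p X Y = extd ω p X Y + extd σ p X Y := by
  simp only [extd, fderiv_fun_add hω hσ]
  simp
  ring

/-- `d² = 0` on functions. -/
theorem extd_fderiv_eq_zero {g : Pt → ℝ} {p : Pt} (hg : ContDiffAt ℝ 2 g p) (X Y : Pt) :
    extd (fderiv ℝ g) p X Y = 0 :=
  sub_eq_zero.mpr (hg.isSymmSndFDerivAt (by simp) X Y)

/-- Closure of the type D, CH₁ structure equations (`d² = 0` applied to `ε`):
if `dP = P₁ω⁰ + Qω¹ + Rω²`, then `Q = C − 2TP` and `R = 2(C + 2T²)ε`. -/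
theorem closure_of_structure_equations
    (T C : ℝ) (U : Set Pt) (hU : IsOpen U)
    (ω0 ω1 ω2 : OneForm)
    (hω0 : ContDiffOn ℝ 1 ω0 U) (hω1 : ContDiffOn ℝ 1 ω1 U) (hω2 : ContDiffOn ℝ 1 ω2 U)
    (hindep : ∀ p ∈ U, LinearIndependent ℝ ![ω0 p, ω1 p, ω2 p])
    (ε P : Pt → ℝ) (hε : ContDiffOn ℝ 2 ε U) (hP : ContDiffOn ℝ 2 P U)
    (h0 : ∀ p ∈ U, ∀ X Y, extd ω0 p X Y = -T * wedge ω0 ω1 p X Y)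
    (h1 : ∀ p ∈ U, ∀ X Y, extd ω1 p X Y = -(4 * T) * wedge ω0 ω2 p X Y)
    (h2 : ∀ p ∈ U, ∀ X Y, extd ω2 p X Y =
        wedge ω0 ω1 p X Y + 2 * ε p * wedge ω0 ω2 p X Y - T * wedge ω1 ω2 p X Y)
    (hdε : ∀ p ∈ U, fderiv ℝ ε p = P p • ω0 p - (T * ε p) • ω1 p + C • ω2 p)
    (P₁ Q R : Pt → ℝ)
    (hdP : ∀ p ∈ U, fderiv ℝ P p = P₁ p • ω0 p + Q p • ω1 p + R p • ω2 p) :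
    ∀ p ∈ U, Q p = C - 2 * T * P p ∧ R p = 2 * (C + 2 * T ^ 2) * ε p := by
  intro p hp
  have hUp : U ∈ nhds p := hU.mem_nhds hp
  have d0 : DifferentiableAt ℝ ω0 p := (hω0.contDiffAt hUp).differentiableAt (by simp)
  have d1 : DifferentiableAt ℝ ω1 p := (hω1.contDiffAt hUp).differentiableAt (by simp)
  have d2 : DifferentiableAt ℝ ω2 p := (hω2.contDiffAt hUp).differentiableAt (by simp)
  have dε : DifferentiableAt ℝ ε p := (hε.contDiffAt hUp).differentiableAt (by simp)
  have dP : DifferentiableAt ℝ P p := (hP.contDiffAt hUp).differentiableAt (by simp)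
  have heq : fderiv ℝ ε =ᶠ[nhds p]
      fun q => P q • ω0 q + ((-T * ε q) • ω1 q + C • ω2 q) := by
    filter_upwards [hUp] with q hq
    rw [hdε q hq, neg_mul]
    module
  have hdTε : fderiv ℝ (fun q => -T * ε q) p = -T • fderiv ℝ ε p := fderiv_const_mul dε (-T)
  have key (X Y : Pt) : wedge (fderiv ℝ P) ω0 p X Y + P p * extd ω0 p X Y
      + (wedge (fderiv ℝ fun q => -T * ε q) ω1 p X Y + -T * ε p * extd ω1 p X Y
        + C * extd ω2 p X Y) = 0 := by
    have dTε : DifferentiableAt ℝ (fun q => -T * ε q) p := dε.const_mul (-T)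
    have hC : extd (fun q => C • ω2 q) p X Y = C * extd ω2 p X Y := by
      rw [extd_smul (g := fun _ => C) (differentiableAt_const C) d2]
      simp [wedge]
    have hz := extd_fderiv_eq_zero (hε.contDiffAt hUp) X Y
    rw [extd, heq.fderiv_eq, ← extd,
      extd_add (ω := fun q => P q • ω0 q) (σ := fun q => (-T * ε q) • ω1 q + C • ω2 q)
        (dP.smul d0) ((dTε.smul d1).add (d2.const_smul C)),
      extd_add (ω := fun q => (-T * ε q) • ω1 q) (σ := fun q => C • ω2 q)
        (dTε.smul d1) (d2.const_smul C),
      extd_smul dP d0, extd_smul dTε d1, hC] at hz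
    exact hz
  simp only [h0 p hp, h1 p hp, h2 p hp, wedge, hdTε, hdP p hp, hdε p hp] at key
  obtain ⟨X, hX⟩ := exists_apply_eq_of_linearIndependent (hindep p hp) ![1, 0, 0]
  obtain ⟨Y, hY⟩ := exists_apply_eq_of_linearIndependent (hindep p hp) ![0, 1, 0]
  obtain ⟨Z, hZ⟩ := exists_apply_eq_of_linearIndependent (hindep p hp) ![0, 0, 1]
  simp only [Fin.forall_fin_succ] at hX hY hZ
  simp at hX hY hZ
  have hXY := key X Y
  have hXZ := key X Z
  simp [hX, hY, hZ] at hXY hXZ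
  constructor <;> linarith
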